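/- arXiv:1304.6797 — 3 statements merged into one kernel-verified Lean document; each statement's English description precedes it below -/
import Mathlib

section
/- Let X be a complete metric space, let (G_n)_{n<ω} be a decreasing sequence of subgroups of the group of bijective self-isometries of X, and let (N_n)_{n<ω} be an increasing sequence of subsets of X such that every g ∈ G_n fixes N_n pointwise. Assume that every G_0-orbit is closed in X, and that for every n < ω, every a ∈ X and every ε > 0 there exist g ∈ G_n and b ∈ N_{n+1} with d(g·a, b) < ε. Then for every a ∈ X there exists a* in the closure of ⋃_{n<ω} N_n with a* ∈ G_0·a. -/
/-- The orbit of `a : X` under a subgroup `G` of the group of bijective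
self-isometries of `X`. -/
def isomOrbit {X : Type*} [MetricSpace X] (G : Subgroup (X ≃ᵢ X)) (a : X) : Set X :=
  {x | ∃ g ∈ G, g a = x}

/-- If `X` is a complete metric space, `(G n)` is a decreasing sequence
of subgroups of the isometry group of `X`, `(N n)` is an increasing sequence of subsets
of `X`, each `g ∈ G n` fixes `N n` pointwise, every `G 0`-orbit is closed, and for every
`n`, `a` and `ε > 0` there are `g ∈ G n` and `b ∈ N (n+1)` with `d(g·a, b) < ε`,
then for every `a ∈ X` there is `a*` in the closure of `⋃ n, N n` lying in the
`G 0`-orbit of `a`. -/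
theorem orbit_realized_in_closure_of_union {X : Type*} [MetricSpace X] [CompleteSpace X]
    (G : ℕ → Subgroup (X ≃ᵢ X)) (N : ℕ → Set X)
    (hGdec : ∀ n, G (n + 1) ≤ G n)
    (hNinc : ∀ n, N n ⊆ N (n + 1))
    (hfix : ∀ n, ∀ g ∈ G n, ∀ x ∈ N n, g x = x)
    (hclosed : ∀ a : X, IsClosed (isomOrbit (G 0) a))
    (hdense : ∀ n, ∀ a : X, ∀ ε > (0 : ℝ), ∃ g ∈ G n, ∃ b ∈ N (n + 1), dist (g a) b < ε) :
    ∀ a : X, ∃ a' ∈ closure (⋃ n, N n), a' ∈ isomOrbit (G 0) a := by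
  intro a
  have hanti : Antitone G := antitone_nat_of_succ_le hGdec
  have hstep : ∀ n x, ∃ y, y ∈ isomOrbit (G n) x ∧ ∃ b ∈ N (n + 1), dist y b < 1 / 2 ^ n := by
    intro n x
    obtain ⟨g, hg, b, hb, hd⟩ := hdense n x (1 / 2 ^ n) (by positivity)
    exact ⟨g x, ⟨g, hg, rfl⟩, b, hb, hd⟩
  choose next horb b hb hd using hstep
  let u : ℕ → X := fun n => Nat.rec a (fun n x => next n x) n
  let c : ℕ → X := fun n => b n (u n)
  have hc : ∀ n, dist (u (n + 1)) (c n) < 1 / 2 ^ n := fun n => hd n (u n)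
  have hu : ∀ n, u n ∈ isomOrbit (G 0) a := by
    intro n
    induction n with
    | zero => exact ⟨1, one_mem _, rfl⟩
    | succ n ih =>
      obtain ⟨g, hg, hga⟩ := ih
      obtain ⟨h, hh, hhu⟩ := horb n (u n)
      refine ⟨h * g, mul_mem (hanti (Nat.zero_le n) hh) hg, ?_⟩
      rw [IsometryEquiv.mul_apply, hga, hhu]
  have hc' : ∀ n, dist (u (n + 2)) (c n) < 1 / 2 ^ n := by
    intro n
    obtain ⟨g, hg, hgu⟩ := horb (n + 1) (u (n + 1))
    have hgc : g (c n) = c n := hfix (n + 1) g hg _ (hb n (u n))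
    have hgu' : g (u (n + 1)) = u (n + 2) := hgu
    rw [← hgu', ← hgc, g.dist_eq]
    exact hc n
  have hcauchy : CauchySeq fun n => u (n + 1) := by
    refine cauchySeq_of_le_geometric_two (C := 4) fun n => ?_
    calc dist (u (n + 1)) (u (n + 2))
        ≤ dist (u (n + 1)) (c n) + dist (u (n + 2)) (c n) := dist_triangle_right _ _ _
      _ ≤ 1 / 2 ^ n + 1 / 2 ^ n := add_le_add (hc n).le (hc' n).le
      _ = 4 / 2 / 2 ^ n := by ring
  obtain ⟨l, hl⟩ := cauchySeq_tendsto_of_complete hcauchy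
  have hdist : Filter.Tendsto (fun n => dist (u (n + 1)) (c n)) Filter.atTop (nhds 0) := by
    refine squeeze_zero (fun _ => dist_nonneg) (fun n => (hc n).le) ?_
    simpa only [one_div_pow] using
      tendsto_pow_atTop_nhds_zero_of_lt_one (r := (1 / 2 : ℝ)) (by norm_num) (by norm_num)
  have hcl : Filter.Tendsto c Filter.atTop (nhds l) := hl.congr_dist hdist
  exact ⟨l, mem_closure_of_tendsto hcl
    (.of_forall fun n => Set.mem_iUnion.2 ⟨n + 1, hb n (u n)⟩),
    (hclosed a).mem_of_tendsto hl (.of_forall fun n => hu (n + 1))⟩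
end

section
/- Let X be a metric space, G a subgroup of the group of bijective self-isometries of X, N ⊆ M subsets of X, and 𝒩 = ⟨N_i : i < σ⟩ a resolution of N. Let (b_n)_{n<ω} be a sequence in X converging to b ∈ X. If b_n is smoothly independent from M over N relative to 𝒩 for every n < ω, then b is smoothly independent from M over N relative to 𝒩. -/
variable {X : Type*} [MetricSpace X]

/-- The pointwise stabilizer `G_A` of `A ⊆ X` inside a subgroup `G` of the
isometry group of `X`. -/
def pstab (G : Subgroup (X ≃ᵢ X)) (A : Set X) : Set (X ≃ᵢ X) :=
  {g | g ∈ G ∧ ∀ x ∈ A, g x = x}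

/-- The Galois type of `a` over `A`: the orbit of `a` under `G_A`. -/
def gtp (G : Subgroup (X ≃ᵢ X)) (a : X) (A : Set X) : Set X :=
  {x | ∃ g ∈ pstab G A, g a = x}

/-- The distance between two sets of points (in particular, between two Galois types):
`d̄(p,q) = inf {d(x,y) : x ∈ p, y ∈ q}`. -/
noncomputable def dbar (p q : Set X) : ℝ :=
  sInf {r : ℝ | ∃ x ∈ p, ∃ y ∈ q, dist x y = r}

/-- `tp(a/M)` `ε`-splits over `N`: there are `A₁, A₂` with `N ⊆ A₁, A₂ ⊆ M` and
`g ∈ G_N` with `g[A₁] = A₂` such that `d̄(tp(g·a/A₂), tp(a/A₂)) ≥ ε`. -/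
def EpsSplits (G : Subgroup (X ≃ᵢ X)) (a : X) (ε : ℝ) (M N : Set X) : Prop :=
  ∃ A₁ A₂ : Set X, N ⊆ A₁ ∧ A₁ ⊆ M ∧ N ⊆ A₂ ∧ A₂ ⊆ M ∧
    ∃ g ∈ pstab G N, (fun x => g x) '' A₁ = A₂ ∧
      ε ≤ dbar (gtp G (g a) A₂) (gtp G a A₂)

/-- `𝒩 = ⟨N_i : i < σ⟩` is a resolution of `N`: an increasing family of subsets of `N`. -/
def IsResolution {σ : Type*} [Preorder σ] (𝒩 : σ → Set X) (N : Set X) : Prop :=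
  Monotone 𝒩 ∧ ∀ i, 𝒩 i ⊆ N

/-- `a` is smoothly independent from `M` over `N` relative to the resolution `𝒩` of `N`:
for every `ε > 0` there is `i` such that `tp(a/M)` does not `ε`-split over `N_i`. -/
def SmoothIndep {σ : Type*} (G : Subgroup (X ≃ᵢ X)) (a : X) (M : Set X)
    (𝒩 : σ → Set X) : Prop :=
  ∀ ε > (0 : ℝ), ∃ i, ¬ EpsSplits G a ε M (𝒩 i)

theorem dbar_gtp_le (G : Subgroup (X ≃ᵢ X)) (A : Set X) (a a' c c' : X) :
    dbar (gtp G a A) (gtp G c A) ≤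
      dbar (gtp G a' A) (gtp G c' A) + (dist a a' + dist c c') := by
  rw [← sub_le_iff_le_add]
  have hone : (1 : X ≃ᵢ X) ∈ pstab G A := ⟨G.one_mem, fun _ _ => rfl⟩
  refine le_csInf ⟨_, _, ⟨1, hone, rfl⟩, _, ⟨1, hone, rfl⟩, rfl⟩ ?_
  rintro r ⟨_, ⟨u, hu, rfl⟩, _, ⟨v, hv, rfl⟩, rfl⟩
  have hle : dbar (gtp G a A) (gtp G c A) ≤ dist (u a) (v c) := by
    refine csInf_le ⟨0, ?_⟩ ⟨_, ⟨u, hu, rfl⟩, _, ⟨v, hv, rfl⟩, rfl⟩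
    rintro r ⟨x, -, y, -, rfl⟩
    exact dist_nonneg
  have htri := dist_triangle4 (u a) (u a') (v c') (v c)
  rw [u.dist_eq, v.dist_eq, dist_comm c' c] at htri
  linarith

/-- If `a` `ε`-splits, then any `c` `(ε - 2 d(a, c))`-splits. -/
theorem EpsSplits.of_dist {G : Subgroup (X ≃ᵢ X)} {a c : X} {ε : ℝ} {M N : Set X}
    (h : EpsSplits G a ε M N) : EpsSplits G c (ε - 2 * dist a c) M N := by
  obtain ⟨A₁, A₂, h₁, h₁M, h₂, h₂M, g, hg, hgA, hε⟩ := h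
  refine ⟨A₁, A₂, h₁, h₁M, h₂, h₂M, g, hg, hgA, ?_⟩
  have hle := dbar_gtp_le G A₂ (g a) (g c) a c
  rw [g.dist_eq] at hle
  linarith

theorem EpsSplits.mono {G : Subgroup (X ≃ᵢ X)} {a : X} {ε ε' : ℝ} {M N : Set X}
    (h : EpsSplits G a ε M N) (hε : ε' ≤ ε) : EpsSplits G a ε' M N := by
  obtain ⟨A₁, A₂, h₁, h₁M, h₂, h₂M, g, hg, hgA, hsplit⟩ := h
  exact ⟨A₁, A₂, h₁, h₁M, h₂, h₂M, g, hg, hgA, hε.trans hsplit⟩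

/-- Continuity of smooth independence: if `b_n → b` and each `b_n` is
smoothly independent from `M` over `N` relative to the resolution `𝒩` of `N`,
then so is `b`. -/
theorem smoothIndep_continuity {σ : Type*} [LinearOrder σ]
    (G : Subgroup (X ≃ᵢ X)) (N M : Set X) (hNM : N ⊆ M)
    (𝒩 : σ → Set X) (hres : IsResolution 𝒩 N)
    (b : ℕ → X) (l : X) (hconv : Filter.Tendsto b Filter.atTop (nhds l))
    (h : ∀ n, SmoothIndep G (b n) M 𝒩) : SmoothIndep G l M 𝒩 := by
  intro ε hε
  obtain ⟨n, hn⟩ := (Metric.tendsto_nhds.mp hconv (ε / 4) (by positivity)).exists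
  obtain ⟨i, hi⟩ := h n (ε / 2) (by positivity)
  refine ⟨i, fun hsplit => hi ((hsplit.of_dist (c := b n)).mono ?_)⟩
  rw [dist_comm] at hn
  linarith
end

section
/- Let X be a metric space, I an index set, and ≤ a transitive relation on I-indexed families 𝒯 = (A_i)_{i∈I} of subsets of X such that 𝒯 ≤ 𝒯' implies A_i ⊆ A'_i for all i ∈ I. Let δ : (0,∞) → (0,∞) satisfy δ(α·ε) = α·δ(ε) for all α, ε > 0, and call a family 𝒯 = (A_i)_{i∈I} δ-reduced if for every 𝒯' = (A'_i)_{i∈I} with 𝒯 ≤ 𝒯', every j ∈ I, every ε > 0 and every b in the closure of ⋃_{i∈I} A_i, d(b, A'_j) < δ(ε) implies d(b, A_j) < ε. Suppose ⟨𝒯_α : α < β⟩ is a ≤-increasing chain of δ-reduced families, define its completed union 𝒯_β by A^β_i := closure(⋃_{α<β} A^α_i) for each i ∈ I, and suppose that every family 𝒯' with 𝒯_β ≤ 𝒯' also satisfies 𝒯_α ≤ 𝒯' for all α < β. Then there exists δ' : (0,∞) → (0,∞) with δ'(α·ε) = α·δ'(ε) for all α, ε > 0 such that 𝒯_β is δ'-reduced.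 -/
variable {X : Type*} [MetricSpace X] {I : Type*}

/-- A family `𝒯 = (A_i)_{i ∈ I}` of subsets of `X` is `δ`-reduced (with respect to an
extension relation `le` on families) if for every `le`-extension `𝒯'` of `𝒯`, every
index `j`, every `ε > 0` and every `b` in the closure of `⋃ i, 𝒯 i`, if
`d(b, 𝒯' j) < δ ε` then `d(b, 𝒯 j) < ε`. -/
def IsReducedTower (le : (I → Set X) → (I → Set X) → Prop) (δ : ℝ → ℝ)
    (𝒯 : I → Set X) : Prop :=
  ∀ 𝒯' : I → Set X, le 𝒯 𝒯' → ∀ j : I, ∀ ε > (0 : ℝ), ∀ b ∈ closure (⋃ i, 𝒯 i),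
    Metric.infDist b (𝒯' j) < δ ε → Metric.infDist b (𝒯 j) < ε

/-- the completed union of a `≤`-increasing chain of `d`-reduced towers
is `d`-reduced (for a possibly different positively homogeneous `δ'`). -/
theorem completed_union_of_reduced_is_reduced
    {γ : Type*} [LinearOrder γ]
    (le : (I → Set X) → (I → Set X) → Prop)
    (hle_trans : ∀ 𝒯₁ 𝒯₂ 𝒯₃ : I → Set X, le 𝒯₁ 𝒯₂ → le 𝒯₂ 𝒯₃ → le 𝒯₁ 𝒯₃)
    (hle_sub : ∀ 𝒯 𝒯' : I → Set X, le 𝒯 𝒯' → ∀ i, 𝒯 i ⊆ 𝒯' i)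
    (δ : ℝ → ℝ)
    (hδpos : ∀ ε > (0 : ℝ), 0 < δ ε)
    (hδhom : ∀ α > (0 : ℝ), ∀ ε > (0 : ℝ), δ (α * ε) = α * δ ε)
    (𝒯 : γ → I → Set X)
    (hchain : ∀ α β : γ, α < β → le (𝒯 α) (𝒯 β))
    (hred : ∀ α : γ, IsReducedTower le δ (𝒯 α))
    (𝒯β : I → Set X)
    (h𝒯β : ∀ i, 𝒯β i = closure (⋃ α : γ, 𝒯 α i))
    (hext : ∀ 𝒯' : I → Set X, le 𝒯β 𝒯' → ∀ α : γ, le (𝒯 α) 𝒯') :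
    ∃ δ' : ℝ → ℝ,
      (∀ ε > (0 : ℝ), 0 < δ' ε) ∧
      (∀ α > (0 : ℝ), ∀ ε > (0 : ℝ), δ' (α * ε) = α * δ' ε) ∧
      IsReducedTower le δ' 𝒯β := by
  have hhalf : ∀ ε > (0 : ℝ), δ (ε / 2) = δ ε / 2 := fun ε hε => by
    rw [div_eq_inv_mul, hδhom _ (by norm_num) ε hε, div_eq_inv_mul]
  have hmono : ∀ α α' : γ, α ≤ α' → ∀ i, 𝒯 α i ⊆ 𝒯 α' i := fun α α' h i => by
    rcases h.eq_or_lt with rfl | h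
    · exact subset_rfl
    · exact hle_sub _ _ (hchain _ _ h) i
  refine ⟨fun ε => δ ε / 2, fun ε hε => half_pos (hδpos ε hε),
    fun α hα ε hε => by simp only [hδhom α hα ε hε, mul_div_assoc], ?_⟩
  intro 𝒯' hT' j ε hε b hb hlt
  rcases (𝒯β j).eq_empty_or_nonempty with hemp | hne
  · simpa [hemp] using hε
  obtain ⟨α₁, x, hx⟩ : ∃ α, (𝒯 α j).Nonempty := by
    rw [h𝒯β, closure_nonempty_iff] at hne
    exact Set.nonempty_iUnion.1 hne
  have hb' : b ∈ closure (⋃ i, ⋃ α, 𝒯 α i) := by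
    refine closure_minimal (Set.iUnion_subset fun i => ?_) isClosed_closure hb
    rw [h𝒯β]
    exact closure_mono (Set.subset_iUnion (fun i => ⋃ α, 𝒯 α i) i)
  obtain ⟨η, hη, hηlt⟩ : ∃ η > 0, η < min (ε / 2) (δ ε / 2 - Metric.infDist b (𝒯' j)) :=
    exists_between (lt_min (half_pos hε) (sub_pos.2 hlt))
  obtain ⟨hη₁, hη₂⟩ := lt_min_iff.1 hηlt
  obtain ⟨c, hc, hbc⟩ := Metric.mem_closure_iff.1 hb' η hη
  simp only [Set.mem_iUnion] at hc
  obtain ⟨i, α₂, hc⟩ := hc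
  -- a stage containing `c` whose `j`-th set is nonempty, so that `infDist` is not a default value
  set α := max α₁ α₂
  have hcα : c ∈ closure (⋃ i, 𝒯 α i) :=
    subset_closure (Set.mem_iUnion.2 ⟨i, hmono _ _ (le_max_right _ _) i hc⟩)
  have hsub : 𝒯 α j ⊆ 𝒯β j := by
    rw [h𝒯β]
    exact (Set.subset_iUnion (fun α => 𝒯 α j) α).trans subset_closure
  have hcdist : Metric.infDist c (𝒯' j) < δ (ε / 2) := by
    have := Metric.infDist_le_infDist_add_dist (s := 𝒯' j) (x := c) (y := b)
    rw [dist_comm] at this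
    rw [hhalf ε hε]
    linarith
  have h₁ := hred α 𝒯' (hext 𝒯' hT' α) j (ε / 2) (half_pos hε) c hcα hcdist
  have h₂ : Metric.infDist b (𝒯β j) ≤ Metric.infDist b (𝒯 α j) :=
    Metric.infDist_le_infDist_of_subset hsub ⟨x, hmono _ _ (le_max_left _ _) j hx⟩
  have h₃ := Metric.infDist_le_infDist_add_dist (s := 𝒯 α j) (x := b) (y := c)
  linarith
end
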